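/- Let d ∈ N and let w : Z^d → (0,∞) be a weight with ∑_{k∈Z^d} w(k)^{-2} < ∞. Let G_d be any one of the three spaces A(T^d), C(T^d), L∞(T^d). Then for every n ∈ N the approximation numbers of the embedding I_d : F_d(w) → G_d satisfy the exact equality a_n(I_d : F_d(w) → G_d) = (∑_{j=n}^∞ σ_j²)^{1/2}. In particular, since σ_j = a_j(I_d : F_d(w) → L₂(T^d)), one has a_n(I_d : F_d(w) → L∞(T^d)) = (∑_{j=n}^∞ a_j(I_d : F_d(w) → L₂(T^d))²)^{1/2}. -/

import Mathlib

open MeasureTheory Filter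
open scoped ENNReal NNReal

noncomputable section

/-- The index lattice `ℤ^d`. -/
abbrev ZLat (d : ℕ) := Fin d → ℤ

instance fact_two_pi_pos : Fact (0 < 2 * Real.pi) := ⟨by positivity⟩

/-- The `d`-dimensional torus `𝕋^d = [0,2π]^d` with endpoints identified. -/
abbrev Torus (d : ℕ) := Fin d → AddCircle (2 * Real.pi)

/-- The normalized Lebesgue measure `(2π)^{-d} dx` on the `d`-torus. -/
def torusMeasure (d : ℕ) : Measure (Torus d) :=
  ((ENNReal.ofReal (2 * Real.pi))⁻¹) ^ d • Measure.pi fun _ => volume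

/-- The character `e^{i k·x}` on the `d`-torus. -/
def torusChar {d : ℕ} (k : ZLat d) (x : Torus d) : ℂ :=
  ∏ j, fourier (k j) (x j)

/-- The `k`-th Fourier coefficient `f̂(k) = (2π)^{-d} ∫_{𝕋^d} f(x) e^{-i k·x} dx`. -/
def fourierCoef {d : ℕ} (f : Torus d → ℂ) (k : ZLat d) : ℂ :=
  ∫ x, (starRingEnd ℂ) (torusChar k x) * f x ∂(torusMeasure d)

/-- The `n`-th approximation number of a bounded linear operator `T`:
`a_n(T) = inf {‖T - A‖ : rank A < n}`. -/
def approxNum {X Y : Type*} [NormedAddCommGroup X] [NormedSpace ℂ X]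
    [NormedAddCommGroup Y] [NormedSpace ℂ Y] (T : X →L[ℂ] Y) (n : ℕ) : ℝ :=
  sInf {c : ℝ | ∃ A : X →L[ℂ] Y,
    Module.rank ℂ (LinearMap.range (A : X →ₗ[ℂ] Y)) < n ∧ c = ‖T - A‖}

/-- `ℓ²(ℤ^d)`; an isometric model of the Hilbert space `F_d(w)` via `f ↦ (w(k)·f̂(k))_k`.
Under this identification the embedding `I_d : F_d(w) → G` is characterized by the
property that the function `T c` has Fourier coefficients `c(k)/w(k)`. -/
abbrev ellTwo (d : ℕ) := lp (fun _ : ZLat d => ℂ) 2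

/-- `ℓ¹(ℤ^d)`; an isometric model of the Wiener algebra `A(𝕋^d)` via `f ↦ (f̂(k))_k`. -/
abbrev ellOne (d : ℕ) := lp (fun _ : ZLat d => ℂ) 1

/-- `ℓ^∞(ℤ^d)`; an isometric model of the space `ℬ(𝕋^d)` of distributions with bounded
Fourier coefficients. -/
abbrev ellInfty (d : ℕ) := lp (fun _ : ZLat d => ℂ) ⊤


/-! ### Fourier analysis on the torus -/

lemma torusMeasure_eq_pi (d : ℕ) :
    torusMeasure d =
      Measure.pi fun _ : Fin d => (AddCircle.haarAddCircle : Measure (AddCircle (2 * Real.pi))) := by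
  symm
  apply Measure.pi_eq
  intro s _
  have h0 : ENNReal.ofReal (2 * Real.pi) ≠ 0 := by simp [Real.pi_pos]
  rw [torusMeasure, Measure.smul_apply, Measure.pi_pi]
  simp only [Measure.smul_apply, smul_eq_mul, AddCircle.volume_eq_smul_haarAddCircle,
    Finset.prod_mul_distrib, Finset.prod_const, Finset.card_univ, Fintype.card_fin]
  rw [← mul_assoc, ← mul_pow, ENNReal.inv_mul_cancel h0 ENNReal.ofReal_ne_top, one_pow, one_mul]

instance isProbabilityMeasure_torusMeasure (d : ℕ) : IsProbabilityMeasure (torusMeasure d) := by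
  rw [torusMeasure_eq_pi]; infer_instance

instance isOpenPosMeasure_torusMeasure (d : ℕ) : (torusMeasure d).IsOpenPosMeasure := by
  rw [torusMeasure_eq_pi]; infer_instance

/-- The character `e^{i k·x}` as a continuous function. -/
def torusMonomial {d : ℕ} (k : ZLat d) : C(Torus d, ℂ) where
  toFun := torusChar k
  continuous_toFun := by unfold torusChar; fun_prop

@[simp] lemma torusMonomial_apply {d : ℕ} (k : ZLat d) (x : Torus d) :
    torusMonomial k x = torusChar k x := rfl

lemma torusChar_neg {d : ℕ} (k : ZLat d) (x : Torus d) :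
    torusChar (-k) x = starRingEnd ℂ (torusChar k x) := by
  simp only [torusChar, Pi.neg_apply, fourier_neg, map_prod]

lemma torusChar_add {d : ℕ} (k l : ZLat d) (x : Torus d) :
    torusChar (k + l) x = torusChar k x * torusChar l x := by
  simp only [torusChar, Pi.add_apply, fourier_add, ← Finset.prod_mul_distrib]

lemma torusChar_zero {d : ℕ} (x : Torus d) : torusChar 0 x = 1 := by
  simp [torusChar]

lemma norm_torusChar {d : ℕ} (k : ZLat d) (x : Torus d) : ‖torusChar k x‖ = 1 := by
  simp only [torusChar, fourier_apply, norm_prod, Circle.norm_coe, Finset.prod_const_one]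

lemma norm_torusMonomial_le {d : ℕ} (k : ZLat d) : ‖torusMonomial k‖ ≤ 1 :=
  (ContinuousMap.norm_le _ zero_le_one).mpr fun x => (norm_torusChar k x).le

lemma torusChar_single {d : ℕ} (i : Fin d) (x : Torus d) :
    torusChar (Pi.single i 1) x = fourier 1 (x i) := by
  rw [torusChar, Finset.prod_eq_single i]
  · simp
  · intro j _ hj
    simp [Pi.single_eq_of_ne hj]
  · simp

/-- The star subalgebra of `C(𝕋^d)` generated by the characters. -/
def trigSubalgebra (d : ℕ) : StarSubalgebra ℂ C(Torus d, ℂ) where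
  toSubalgebra := Algebra.adjoin ℂ (Set.range torusMonomial)
  star_mem' := by
    change Algebra.adjoin ℂ (Set.range torusMonomial) ≤
      star (Algebra.adjoin ℂ (Set.range torusMonomial))
    refine Algebra.adjoin_le ?_
    rintro _ ⟨k, rfl⟩
    refine Algebra.subset_adjoin ⟨-k, ?_⟩
    ext1 x
    simp only [torusMonomial_apply, torusChar_neg, starRingEnd_apply, ContinuousMap.star_apply]

lemma trigSubalgebra_toSubmodule (d : ℕ) :
    (trigSubalgebra d).toSubalgebra.toSubmodule = Submodule.span ℂ (Set.range torusMonomial) := by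
  apply Algebra.adjoin_eq_span_of_subset
  refine .trans (fun x ↦ Submonoid.closure_induction (fun _ ↦ id) ⟨0, ?_⟩ ?_)
    Submodule.subset_span
  · ext x
    simp [torusChar_zero]
  · rintro _ _ _ _ ⟨k, rfl⟩ ⟨l, rfl⟩
    exact ⟨k + l, by ext x; simp [torusChar_add]⟩

lemma trigSubalgebra_separatesPoints (d : ℕ) : (trigSubalgebra d).SeparatesPoints := by
  intro x y hxy
  rw [Ne, funext_iff, not_forall] at hxy
  obtain ⟨i, hi⟩ := hxy
  refine ⟨_, ⟨torusMonomial (Pi.single i 1), Algebra.subset_adjoin ⟨Pi.single i 1, rfl⟩, rfl⟩, ?_⟩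
  change torusChar _ x ≠ torusChar _ y
  rw [torusChar_single, torusChar_single, fourier_one, fourier_one]
  contrapose hi
  exact AddCircle.injective_toCircle (by positivity) (Circle.ext hi)

lemma span_torusMonomial_closure_eq_top (d : ℕ) :
    (Submodule.span ℂ (Set.range (torusMonomial (d := d)))).topologicalClosure = ⊤ := by
  rw [← trigSubalgebra_toSubmodule]
  exact congr_arg (Subalgebra.toSubmodule <| StarSubalgebra.toSubalgebra ·)
    (ContinuousMap.starSubalgebra_topologicalClosure_eq_top_of_separatesPoints _
      (trigSubalgebra_separatesPoints d))

/-- The characters as elements of `L₂(𝕋^d)`. -/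
def torusMonomialL2 {d : ℕ} (k : ZLat d) : Lp ℂ 2 (torusMeasure d) :=
  ContinuousMap.toLp 2 (torusMeasure d) ℂ (torusMonomial k)

lemma coeFn_torusMonomialL2 {d : ℕ} (k : ZLat d) :
    torusMonomialL2 k =ᵐ[torusMeasure d] torusChar k :=
  ContinuousMap.coeFn_toLp _ _

lemma span_torusMonomialL2_closure_eq_top (d : ℕ) :
    (Submodule.span ℂ (Set.range (torusMonomialL2 (d := d)))).topologicalClosure = ⊤ := by
  have h := (ContinuousMap.toLp_denseRange ℂ (torusMeasure d) ℂ
    (p := 2) (by simp)).topologicalClosure_map_submodule (span_torusMonomial_closure_eq_top d)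
  rw [Submodule.map_span, ← Set.range_comp] at h
  exact h

lemma orthonormal_torusMonomialL2 (d : ℕ) : Orthonormal ℂ (torusMonomialL2 (d := d)) := by
  rw [orthonormal_iff_ite]
  intro k l
  rw [torusMonomialL2, torusMonomialL2, ContinuousMap.inner_toLp]
  simp only [torusMonomial_apply, ← torusChar_neg, ← torusChar_add]
  split_ifs with h
  · simp [h, torusChar_zero]
  simp only [torusChar, torusMeasure_eq_pi]
  rw [MeasureTheory.integral_fintype_prod_eq_prod (𝕜 := ℂ)
    (f := fun i x => (fourier ((l + -k) i) x : ℂ))]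
  obtain ⟨i, hi⟩ := Function.ne_iff.mp h
  apply Finset.prod_eq_zero (Finset.mem_univ i)
  simpa only [eq_false_intro hi, if_false, ContinuousMap.inner_toLp, ← fourier_neg,
    ← fourier_add] using! (orthonormal_iff_ite.mp <| orthonormal_fourier) (k i) (l i)

/-- The Hilbert basis of `L₂(𝕋^d)` given by the characters. -/
def torusBasis (d : ℕ) : HilbertBasis (ZLat d) ℂ (Lp ℂ 2 (torusMeasure d)) :=
  HilbertBasis.mk (orthonormal_torusMonomialL2 d) (span_torusMonomialL2_closure_eq_top d).ge

@[simp] lemma coe_torusBasis (d : ℕ) : ⇑(torusBasis d) = torusMonomialL2 :=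
  HilbertBasis.coe_mk _ _

lemma fourierCoef_congr {d : ℕ} {f g : Torus d → ℂ} (h : f =ᵐ[torusMeasure d] g) (k : ZLat d) :
    fourierCoef f k = fourierCoef g k := by
  refine integral_congr_ae ?_
  filter_upwards [h] with x hx
  rw [hx]

lemma torusBasis_repr {d : ℕ} (f : Lp ℂ 2 (torusMeasure d)) (k : ZLat d) :
    (torusBasis d).repr f k = fourierCoef f k := by
  rw [HilbertBasis.repr_apply_apply, L2.inner_def, coe_torusBasis]
  refine integral_congr_ae ?_
  filter_upwards [coeFn_torusMonomialL2 k] with x hx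
  rw [RCLike.inner_apply, hx, mul_comm]

lemma ae_eq_of_fourierCoef_eq {d : ℕ} {f g : Torus d → ℂ} (hf : MemLp f 2 (torusMeasure d))
    (hg : MemLp g 2 (torusMeasure d)) (h : ∀ k, fourierCoef f k = fourierCoef g k) :
    f =ᵐ[torusMeasure d] g := by
  have : hf.toLp f = hg.toLp g := by
    apply (torusBasis d).repr.injective
    ext k
    rw [torusBasis_repr, torusBasis_repr, fourierCoef_congr hf.coeFn_toLp,
      fourierCoef_congr hg.coeFn_toLp, h]
  exact (MemLp.toLp_eq_toLp_iff hf hg).1 this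

lemma eq_of_fourierCoef_eq {d : ℕ} {f g : C(Torus d, ℂ)}
    (h : ∀ k, fourierCoef f k = fourierCoef g k) : f = g := by
  apply ContinuousMap.toLp_injective (p := 2) (𝕜 := ℂ) (torusMeasure d)
  apply (torusBasis d).repr.injective
  ext k
  rw [torusBasis_repr, torusBasis_repr, fourierCoef_congr (ContinuousMap.coeFn_toLp _ f),
    fourierCoef_congr (ContinuousMap.coeFn_toLp _ g), h]

lemma summable_norm_ellOne {d : ℕ} (a : ellOne d) : Summable fun k => ‖a k‖ := by
  simpa using (lp.memℓp a).summable (by simp)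

lemma norm_smul_torusMonomial_le {d : ℕ} (z : ℂ) (k : ZLat d) : ‖z • torusMonomial k‖ ≤ ‖z‖ := by
  rw [norm_smul]
  exact mul_le_of_le_one_right (norm_nonneg _) (norm_torusMonomial_le k)

lemma summable_norm_smul_torusMonomial {d : ℕ} (a : ellOne d) :
    Summable fun k => ‖a k • torusMonomial k‖ :=
  (summable_norm_ellOne a).of_nonneg_of_le (fun _ => norm_nonneg _)
    fun k => norm_smul_torusMonomial_le (a k) k

/-- The sum of the Fourier series with absolutely summable coefficients: the embedding of the
Wiener algebra into `C(𝕋^d)`. -/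
def wienerEmbedding (d : ℕ) : ellOne d →L[ℂ] C(Torus d, ℂ) :=
  LinearMap.mkContinuous
    { toFun := fun a => ∑' k, a k • torusMonomial k
      map_add' := fun a b => by
        simp only [lp.coeFn_add, Pi.add_apply, add_smul]
        exact (summable_norm_smul_torusMonomial a).of_norm.tsum_add
          (summable_norm_smul_torusMonomial b).of_norm
      map_smul' := fun c a => by
        simp only [lp.coeFn_smul, Pi.smul_apply, smul_assoc, RingHom.id_apply]
        exact (summable_norm_smul_torusMonomial a).of_norm.tsum_const_smul c } 1 (by
    intro a
    refine (norm_tsum_le_tsum_norm (summable_norm_smul_torusMonomial a)).trans ?_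
    have h1 : ‖a‖ = ∑' k, ‖a k‖ := by simpa using lp.norm_eq_tsum_rpow (by simp) a
    rw [one_mul, h1]
    exact (summable_norm_smul_torusMonomial a).tsum_le_tsum
      (fun k => norm_smul_torusMonomial_le (a k) k) (summable_norm_ellOne a))

lemma hasSum_wienerEmbedding {d : ℕ} (a : ellOne d) :
    HasSum (fun k => a k • torusMonomial k) (wienerEmbedding d a) :=
  (summable_norm_smul_torusMonomial a).of_norm.hasSum

lemma norm_wienerEmbedding_le (d : ℕ) : ‖wienerEmbedding d‖ ≤ 1 :=
  LinearMap.mkContinuous_norm_le _ zero_le_one _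

lemma fourierCoef_wienerEmbedding {d : ℕ} (a : ellOne d) (k : ZLat d) :
    fourierCoef (wienerEmbedding d a) k = a k := by
  have h2 := ((hasSum_wienerEmbedding a).mapL (ContinuousMap.toLp 2 (torusMeasure d) ℂ)).mapL
    (innerSL ℂ (torusMonomialL2 k))
  have h3 : ∀ l, innerSL ℂ (torusMonomialL2 k)
      (ContinuousMap.toLp 2 (torusMeasure d) ℂ (a l • torusMonomial l)) =
      if l = k then a k else 0 := by
    intro l
    rw [map_smul, innerSL_apply_apply, inner_smul_right]
    change a l * inner ℂ (torusMonomialL2 k) (torusMonomialL2 l) = _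
    rw [orthonormal_iff_ite.1 (orthonormal_torusMonomialL2 d) k l]
    by_cases h : l = k
    · simp [h]
    · simp [h, Ne.symm h]
  simp only [h3] at h2
  rw [← h2.unique (hasSum_ite_eq k (a k)),
    ← fourierCoef_congr (ContinuousMap.coeFn_toLp (p := 2) (𝕜 := ℂ) (torusMeasure d) _) k,
    ← torusBasis_repr, HilbertBasis.repr_apply_apply, coe_torusBasis, innerSL_apply_apply]

/-! ### Operators into `L_∞` are Hilbert–Schmidt operators into `L₂` -/

section LInfty

variable {α : Type*} [MeasurableSpace α] {μ : Measure α}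

lemma ae_norm_le_norm_linfty (f : Lp ℂ ⊤ μ) : ∀ᵐ x ∂μ, ‖f x‖ ≤ ‖f‖ := by
  filter_upwards [ae_le_eLpNormEssSup (f := f) (μ := μ)] with x hx
  rw [← eLpNorm_exponent_top] at hx
  rw [Lp.norm_def, ← toReal_enorm]
  exact ENNReal.toReal_mono (Lp.eLpNorm_ne_top f) hx

lemma ae_sum_norm_sq_le {ι : Type*} [Fintype ι] (f : ι → Lp ℂ ⊤ μ) {C : ℝ}
    (h : ∀ a : EuclideanSpace ℂ ι, ‖∑ i, a i • f i‖ ≤ C * ‖a‖) :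
    ∀ᵐ x ∂μ, ∑ i, ‖f i x‖ ^ 2 ≤ C ^ 2 := by
  have h1 : ∀ a : EuclideanSpace ℂ ι, ∀ᵐ x ∂μ, ‖∑ i, a i * f i x‖ ≤ C * ‖a‖ := by
    intro a
    have h3 : ∀ᵐ x ∂μ, ∀ i, (a i • f i) x = a i * f i x := by
      rw [ae_all_iff]
      intro i
      filter_upwards [Lp.coeFn_smul (a i) (f i)] with x hx
      rw [hx, Pi.smul_apply, smul_eq_mul]
    filter_upwards [ae_norm_le_norm_linfty (∑ i, a i • f i),
      Lp.coeFn_finsetSum Finset.univ (fun i => a i • f i), h3] with x hx1 hx2 hx3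
    rw [hx2, Finset.sum_apply] at hx1
    simp only [hx3] at hx1
    exact hx1.trans (h a)
  have h2 := ae_all_iff.2 fun n : ℕ =>
    h1 (TopologicalSpace.denseSeq (EuclideanSpace ℂ ι) n)
  filter_upwards [h2] with x hx
  have h3 : ∀ a : EuclideanSpace ℂ ι, ‖∑ i, a i * f i x‖ ≤ C * ‖a‖ := by
    intro a
    refine (TopologicalSpace.denseRange_denseSeq (EuclideanSpace ℂ ι)).induction_on a ?_ hx
    exact isClosed_le (by fun_prop) (by fun_prop)
  have h4 := h3 (WithLp.toLp 2 fun i => starRingEnd ℂ (f i x))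
  have h5 : ‖∑ i, starRingEnd ℂ (f i x) * f i x‖ = ∑ i, ‖f i x‖ ^ 2 := by
    simp only [Complex.conj_mul']
    norm_cast
    exact Real.norm_of_nonneg (by positivity)
  have h6 : ‖(WithLp.toLp 2 fun i => starRingEnd ℂ (f i x) : EuclideanSpace ℂ ι)‖ ^ 2
      = ∑ i, ‖f i x‖ ^ 2 := by
    simp [EuclideanSpace.norm_sq_eq]
  simp only [h5] at h4
  rw [← h6] at h4 ⊢
  set t := ‖(WithLp.toLp 2 fun i => starRingEnd ℂ (f i x) : EuclideanSpace ℂ ι)‖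
  have ht : 0 ≤ t := norm_nonneg _
  rcases ht.eq_or_lt with h0 | h0
  · rw [← h0, zero_pow two_ne_zero]; exact sq_nonneg C
  · exact pow_le_pow_left₀ ht (le_of_mul_le_mul_right (by rwa [← sq]) h0) 2

/-- The inclusion of `L_∞` into `L₂` over a finite measure space. -/
def linftyToL2 (μ : Measure α) [IsFiniteMeasure μ] : Lp ℂ ⊤ μ →ₗ[ℂ] Lp ℂ 2 μ where
  toFun f := ((Lp.memLp f).mono_exponent le_top).toLp f
  map_add' f g := by
    rw [← MemLp.toLp_add, MemLp.toLp_eq_toLp_iff]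
    exact Lp.coeFn_add f g
  map_smul' c f := by
    rw [RingHom.id_apply, ← MemLp.toLp_const_smul, MemLp.toLp_eq_toLp_iff]
    exact Lp.coeFn_smul c f

lemma coeFn_linftyToL2 [IsFiniteMeasure μ] (f : Lp ℂ ⊤ μ) : linftyToL2 μ f =ᵐ[μ] f :=
  MemLp.coeFn_toLp ((Lp.memLp f).mono_exponent le_top)

lemma sum_norm_sq_linftyToL2_le [IsProbabilityMeasure μ] {ι : Type*} [Fintype ι]
    (f : ι → Lp ℂ ⊤ μ) {C : ℝ} (h : ∀ a : EuclideanSpace ℂ ι, ‖∑ i, a i • f i‖ ≤ C * ‖a‖) :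
    ∑ i, ‖linftyToL2 μ (f i)‖ ^ 2 ≤ C ^ 2 := by
  have h1 : ((∑ i, ‖linftyToL2 μ (f i)‖ ^ 2 : ℝ) : ℂ) =
      ∫ x, ∑ i, inner ℂ (linftyToL2 μ (f i) x) (linftyToL2 μ (f i) x) ∂μ := by
    rw [integral_finsetSum _ fun i _ => L2.integrable_inner _ _]
    push_cast
    refine Finset.sum_congr rfl fun i _ => ?_
    rw [← L2.inner_def, inner_self_eq_norm_sq_to_K]
    rfl
  have h2 : ∀ᵐ x ∂μ, ∀ i, linftyToL2 μ (f i) x = f i x :=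
    ae_all_iff.2 fun i => coeFn_linftyToL2 (f i)
  have h3 := norm_integral_le_of_norm_le_const (μ := μ) (C := C ^ 2)
    (f := fun x => ∑ i, inner ℂ (linftyToL2 μ (f i) x) (linftyToL2 μ (f i) x)) (by
      filter_upwards [h2, ae_sum_norm_sq_le f h] with x hx hx'
      refine (norm_sum_le _ _).trans (le_trans (Finset.sum_le_sum fun i _ => ?_) hx')
      rw [hx i, sq]
      exact norm_inner_le_norm _ _)
  rw [← h1, probReal_univ, mul_one, Complex.norm_real] at h3
  exact (le_abs_self _).trans h3

lemma sum_norm_sq_linftyToL2_apply_le [IsProbabilityMeasure μ] {ι H : Type*} [Fintype ι]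
    [NormedAddCommGroup H] [InnerProductSpace ℂ H] (S : H →L[ℂ] Lp ℂ ⊤ μ) {u : ι → H}
    (hu : Orthonormal ℂ u) : ∑ i, ‖linftyToL2 μ (S (u i))‖ ^ 2 ≤ ‖S‖ ^ 2 := by
  refine sum_norm_sq_linftyToL2_le _ fun a => ?_
  have h1 : ‖∑ i, a i • u i‖ = ‖a‖ := by
    rw [← sq_eq_sq₀ (norm_nonneg _) (norm_nonneg _), EuclideanSpace.norm_sq_eq,
      ← inner_self_eq_norm_sq (𝕜 := ℂ), hu.inner_sum]
    simp [Complex.conj_mul', ← Complex.ofReal_pow]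
  rw [← h1]
  simpa only [map_sum, map_smul] using S.le_opNorm (∑ i, a i • u i)

end LInfty

/-! ### Finite rank perturbations of diagonal operators -/

lemma sum_norm_sq_starProjection_le {H : Type*} [NormedAddCommGroup H] [InnerProductSpace ℂ H]
    {ι : Type*} {e : ι → H} (he : Orthonormal ℂ e) (F : Submodule ℂ H) [FiniteDimensional ℂ F]
    (s : Finset ι) : ∑ j ∈ s, ‖F.starProjection (e j)‖ ^ 2 ≤ Module.finrank ℂ F := by
  let v := stdOrthonormalBasis ℂ F
  have h1 : ∀ x : H, ‖F.starProjection x‖ ^ 2 = ∑ i, ‖inner ℂ x (v i : H)‖ ^ 2 := by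
    intro x
    rw [Submodule.starProjection_apply, ← Submodule.coe_norm, ← v.sum_sq_norm_inner_left]
    refine Finset.sum_congr rfl fun i _ => ?_
    rw [Submodule.coe_inner, ← Submodule.starProjection_apply,
      Submodule.inner_starProjection_left_eq_right, Submodule.starProjection_mem_subspace_eq_self]
  simp only [h1]
  rw [Finset.sum_comm]
  calc _ ≤ ∑ i, ‖(v i : H)‖ ^ 2 :=
        Finset.sum_le_sum fun i _ => he.sum_inner_products_le (v i : H)
    _ = Module.finrank ℂ F := by
        simp [Submodule.norm_coe, v.orthonormal.1]

lemma mul_one_sub_le_norm_sq_sub {H : Type*} [NormedAddCommGroup H] [InnerProductSpace ℂ H]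
    (F : Submodule ℂ H) [F.HasOrthogonalProjection] {x y : H} (hx : ‖x‖ = 1) (hy : y ∈ F) (t : ℝ) :
    t ^ 2 * (1 - ‖F.starProjection x‖ ^ 2) ≤ ‖(t : ℂ) • x - y‖ ^ 2 := by
  have h1 := Submodule.norm_sq_eq_add_norm_sq_starProjection x F
  have h2 : Fᗮ.starProjection ((t : ℂ) • x - y) = (t : ℂ) • Fᗮ.starProjection x := by
    rw [map_sub, map_smul, Submodule.starProjection_orthogonal_apply_eq_zero hy, sub_zero]
  have h3 := Fᗮ.norm_starProjection_apply_le ((t : ℂ) • x - y)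
  rw [hx] at h1
  have h4 : (1 : ℝ) - ‖F.starProjection x‖ ^ 2 = ‖Fᗮ.starProjection x‖ ^ 2 := by linarith
  rw [h2] at h3
  rw [h4]
  calc _ = ‖(t : ℂ) • Fᗮ.starProjection x‖ ^ 2 := by
        rw [norm_smul, Complex.norm_real, mul_pow, Real.norm_eq_abs, sq_abs]
    _ ≤ _ := pow_le_pow_left₀ (norm_nonneg _) h3 2

lemma sum_tail_le_sum_mul_one_sub {s q : ℕ → ℝ} (hs : Antitone s) (hs0 : ∀ j, 0 ≤ s j)
    (hq0 : ∀ j, 0 ≤ q j) (hq1 : ∀ j, q j ≤ 1) (n m : ℕ)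
    (hq : ∑ j ∈ Finset.range (n + m), q j ≤ n) :
    ∑ j ∈ Finset.range m, s (n + j) ≤ ∑ j ∈ Finset.range (n + m), s j * (1 - q j) := by
  rw [Finset.sum_range_add] at hq ⊢
  have h1 : s n * ∑ j ∈ Finset.range n, (1 - q j) ≤ ∑ j ∈ Finset.range n, s j * (1 - q j) := by
    rw [Finset.mul_sum]
    exact Finset.sum_le_sum fun j hj => mul_le_mul_of_nonneg_right
      (hs (Finset.mem_range.1 hj).le) (sub_nonneg.2 (hq1 j))
  have h2 : ∑ j ∈ Finset.range m, s (n + j) * q (n + j) ≤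
      s n * ∑ j ∈ Finset.range m, q (n + j) := by
    rw [Finset.mul_sum]
    exact Finset.sum_le_sum fun j _ => mul_le_mul_of_nonneg_right
      (hs (Nat.le_add_right n j)) (hq0 _)
  have h3 : s n * ∑ j ∈ Finset.range m, q (n + j) ≤ s n * ∑ j ∈ Finset.range n, (1 - q j) := by
    refine mul_le_mul_of_nonneg_left ?_ (hs0 n)
    simp only [Finset.sum_sub_distrib, Finset.sum_const, Finset.card_range, nsmul_eq_mul, mul_one]
    linarith
  simp only [mul_sub, mul_one, Finset.sum_sub_distrib] at h1 h3 ⊢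
  linarith

lemma sum_tail_sq_le_sum_norm_sq {H : Type*} [NormedAddCommGroup H] [InnerProductSpace ℂ H]
    {e : ℕ → H} (he : Orthonormal ℂ e) {σ : ℕ → ℝ} (hσ : Antitone σ) (hσ0 : ∀ j, 0 ≤ σ j)
    (F : Submodule ℂ H) [FiniteDimensional ℂ F] {n : ℕ} (hF : Module.finrank ℂ F ≤ n)
    {y : ℕ → H} (hy : ∀ j, y j ∈ F) (m : ℕ) :
    ∑ j ∈ Finset.range m, σ (n + j) ^ 2 ≤
      ∑ j ∈ Finset.range (n + m), ‖(σ j : ℂ) • e j - y j‖ ^ 2 := by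
  refine (sum_tail_le_sum_mul_one_sub (s := fun j => σ j ^ 2)
    (q := fun j => ‖F.starProjection (e j)‖ ^ 2)
    (fun i j hij => pow_le_pow_left₀ (hσ0 j) (hσ hij) 2) (fun j => sq_nonneg _)
    (fun j => sq_nonneg _) (fun j => ?_) n m ?_).trans
    (Finset.sum_le_sum fun j _ => mul_one_sub_le_norm_sq_sub F (he.1 j) (hy j) (σ j))
  · exact pow_le_one₀ (norm_nonneg _) ((F.norm_starProjection_apply_le _).trans (he.1 j).le)
  · exact (sum_norm_sq_starProjection_le he F _).trans (by exact_mod_cast hF)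

/-! ### Approximation numbers -/

section ApproxNum

variable {X Y : Type*} [NormedAddCommGroup X] [NormedSpace ℂ X]
  [NormedAddCommGroup Y] [NormedSpace ℂ Y]

lemma approxNum_le_norm_sub (T A : X →L[ℂ] Y) {n : ℕ}
    (hA : Module.rank ℂ (LinearMap.range (A : X →ₗ[ℂ] Y)) < n) : approxNum T n ≤ ‖T - A‖ :=
  csInf_le ⟨0, by rintro _ ⟨A, -, rfl⟩; exact norm_nonneg _⟩ ⟨A, hA, rfl⟩

lemma le_approxNum_succ (T : X →L[ℂ] Y) {n : ℕ} {B : ℝ}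
    (h : ∀ A : X →L[ℂ] Y, FiniteDimensional ℂ (LinearMap.range (A : X →ₗ[ℂ] Y)) →
      Module.finrank ℂ (LinearMap.range (A : X →ₗ[ℂ] Y)) ≤ n → B ≤ ‖T - A‖) :
    B ≤ approxNum T (n + 1) := by
  refine le_csInf ⟨_, 0, ?_, rfl⟩ ?_
  · simp
  · rintro _ ⟨A, hA, rfl⟩
    have hfin : FiniteDimensional ℂ (LinearMap.range (A : X →ₗ[ℂ] Y)) :=
      Module.rank_lt_aleph0_iff.1 (hA.trans Cardinal.natCast_lt_aleph0)
    refine h A hfin ?_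
    rw [← Module.finrank_eq_rank, Nat.cast_lt] at hA
    exact Nat.lt_succ_iff.1 hA

end ApproxNum

lemma orthonormal_lp_single {ι : Type*} [DecidableEq ι] :
    Orthonormal ℂ fun i : ι => lp.single (E := fun _ : ι => ℂ) 2 i 1 := by
  rw [orthonormal_iff_ite]
  intro i j
  rw [lp.inner_single_left, lp.single_apply, Pi.single_apply]
  simp

lemma lp_two_norm_le_of_forall {ι : Type*} {x y : lp (fun _ : ι => ℂ) 2} {C : ℝ} (hC : 0 ≤ C)
    (h : ∀ i, ‖x i‖ ≤ C * ‖y i‖) : ‖x‖ ≤ C * ‖y‖ := by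
  refine lp.norm_le_of_forall_sum_le (by simp) (by positivity) fun s => ?_
  have h1 := lp.sum_rpow_le_norm_rpow (p := 2) (by simp) y s
  simp only [ENNReal.toReal_ofNat, Real.rpow_ofNat] at h1 ⊢
  calc ∑ i ∈ s, ‖x i‖ ^ 2 ≤ ∑ i ∈ s, C ^ 2 * ‖y i‖ ^ 2 := Finset.sum_le_sum fun i _ => by
        rw [← mul_pow]; exact pow_le_pow_left₀ (norm_nonneg _) (h i) 2
    _ ≤ (C * ‖y‖) ^ 2 := by
        rw [← Finset.mul_sum, mul_pow]
        exact mul_le_mul_of_nonneg_left h1 (sq_nonneg C)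

lemma approxNum_succ_le_of_forall {ι : Type*} {Y : Type*} [NormedAddCommGroup Y]
    [NormedSpace ℂ Y] (T : lp (fun _ : ι => ℂ) 2 →L[ℂ] Y) (e : ℕ → ι) {n : ℕ} {B : ℝ}
    (hB : 0 ≤ B)
    (h : ∀ c : lp (fun _ : ι => ℂ) 2, (∀ j < n, c (e j) = 0) → ‖T c‖ ≤ B * ‖c‖) :
    approxNum T (n + 1) ≤ B := by
  classical
  let v : Finset (lp (fun _ : ι => ℂ) 2) := (Finset.range n).image fun j => lp.single 2 (e j) 1
  let K : Submodule ℂ (lp (fun _ : ι => ℂ) 2) := Submodule.span ℂ v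
  have hrank : Module.rank ℂ K ≤ n := (rank_span_finset_le v).trans <| by
    exact_mod_cast Finset.card_image_le.trans (Finset.card_range n).le
  have : FiniteDimensional ℂ K := FiniteDimensional.span_finset ℂ v
  refine (approxNum_le_norm_sub T ((T ∘L K.subtypeL) ∘L K.orthogonalProjectionOnto) ?_).trans ?_
  · refine lt_of_le_of_lt ?_ (Nat.cast_lt.2 (Nat.lt_succ_self n))
    let L : K →ₗ[ℂ] Y := ((T ∘L K.subtypeL : K →L[ℂ] Y) : K →ₗ[ℂ] Y)
    refine (Submodule.rank_mono (LinearMap.range_comp_le_range _ L)).trans ?_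
    rw [← Module.finrank_eq_rank]
    exact_mod_cast (LinearMap.finrank_range_le L).trans (Module.finrank_le_of_rank_le hrank)
  · refine ContinuousLinearMap.opNorm_le_bound _ hB fun c => ?_
    have h1 : (T - (T ∘L K.subtypeL) ∘L K.orthogonalProjectionOnto) c =
        T (Kᗮ.starProjection c) := by
      rw [Submodule.starProjection_orthogonal_val, map_sub]
      rfl
    rw [h1]
    refine (h _ fun j hj => ?_).trans
      (mul_le_mul_of_nonneg_left (Submodule.norm_starProjection_apply_le _ c) hB)
    have h2 : inner ℂ (lp.single 2 (e j) 1) (Kᗮ.starProjection c) = 0 :=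
      Submodule.inner_right_of_mem_orthogonal (K := K)
        (Submodule.subset_span (Finset.mem_coe.2
          (Finset.mem_image.2 ⟨j, Finset.mem_range.2 hj, rfl⟩)))
        (Submodule.starProjection_apply_mem _ c)
    rw [lp.inner_single_left] at h2
    simpa using h2

/-! ### The embeddings of `F_d(w)` -/

section Embeddings

variable {d : ℕ} {w : ZLat d → ℝ} {σ : ℕ → ℝ} {e : ℕ ≃ ZLat d}

lemma summable_rearrangement_sq (hsum : Summable fun k : ZLat d => (w k)⁻¹ ^ 2)
    (hσe : ∀ j, σ j = (w (e j))⁻¹) : Summable fun j => σ j ^ 2 := by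
  simp only [hσe]
  exact (e.summable_iff (f := fun k => (w k)⁻¹ ^ 2)).2 hsum

lemma summable_rearrangement_sq_tail (hsum : Summable fun k : ZLat d => (w k)⁻¹ ^ 2)
    (hσe : ∀ j, σ j = (w (e j))⁻¹) (n : ℕ) : Summable fun j => σ (n + j) ^ 2 :=
  (summable_rearrangement_sq hsum hσe).comp_injective (add_right_injective n)

lemma sum_norm_div_le (hw : ∀ k, 0 < w k) (hsum : Summable fun k : ZLat d => (w k)⁻¹ ^ 2)
    (hσe : ∀ j, σ j = (w (e j))⁻¹) {n : ℕ} (c : ellTwo d) (hc : ∀ j < n, c (e j) = 0)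
    (s : Finset (ZLat d)) :
    ∑ k ∈ s, ‖c k / (w k : ℂ)‖ ≤ Real.sqrt (∑' j : ℕ, σ (n + j) ^ 2) * ‖c‖ := by
  have h1 : ∑ k ∈ s, ‖c k / (w k : ℂ)‖ =
      ∑ k ∈ s with n ≤ e.symm k, (w k)⁻¹ * ‖c k‖ := by
    rw [Finset.sum_filter]
    refine Finset.sum_congr rfl fun k _ => ?_
    split_ifs with h
    · rw [norm_div, Complex.norm_real, Real.norm_of_nonneg (hw k).le, div_eq_inv_mul]
    · have := hc (e.symm k) (not_le.1 h)
      rw [e.apply_symm_apply] at this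
      simp [this]
  have h2 : ∑ k ∈ s with n ≤ e.symm k, ‖c k‖ ^ 2 ≤ ‖c‖ ^ 2 := by
    simpa using lp.sum_rpow_le_norm_rpow (p := 2) (by simp) c (s.filter fun k => n ≤ e.symm k)
  have h3 : ∑ k ∈ s with n ≤ e.symm k, (w k)⁻¹ ^ 2 ≤ ∑' j : ℕ, σ (n + j) ^ 2 := by
    have hinj : Set.InjOn (fun k => e.symm k - n) (s.filter fun k => n ≤ e.symm k) := by
      intro a ha b hb hab
      have ha' := (Finset.mem_filter.1 ha).2
      have hb' := (Finset.mem_filter.1 hb).2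
      apply e.symm.injective
      change e.symm a - n = e.symm b - n at hab
      omega
    calc ∑ k ∈ s with n ≤ e.symm k, (w k)⁻¹ ^ 2
        = ∑ k ∈ s with n ≤ e.symm k, σ (n + (e.symm k - n)) ^ 2 := by
          refine Finset.sum_congr rfl fun k hk => ?_
          rw [Nat.add_sub_cancel' (Finset.mem_filter.1 hk).2, hσe, e.apply_symm_apply]
      _ = ∑ j ∈ (s.filter fun k => n ≤ e.symm k).image fun k => e.symm k - n, σ (n + j) ^ 2 :=
          (Finset.sum_image (f := fun j => σ (n + j) ^ 2) hinj).symm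
      _ ≤ _ := (summable_rearrangement_sq_tail hsum hσe n).sum_le_tsum _
          fun _ _ => sq_nonneg _
  rw [h1]
  refine (Real.sum_mul_le_sqrt_mul_sqrt _ _ _).trans ?_
  refine mul_le_mul (Real.sqrt_le_sqrt h3) ?_ (Real.sqrt_nonneg _) (Real.sqrt_nonneg _)
  exact Real.sqrt_le_iff.2 ⟨norm_nonneg _, h2⟩

lemma norm_le_of_eq_div (hw : ∀ k, 0 < w k) (hsum : Summable fun k : ZLat d => (w k)⁻¹ ^ 2)
    (hσe : ∀ j, σ j = (w (e j))⁻¹) {n : ℕ} {c : ellTwo d} (hc : ∀ j < n, c (e j) = 0)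
    {a : ellOne d} (ha : ∀ k, a k = c k / (w k : ℂ)) :
    ‖a‖ ≤ Real.sqrt (∑' j : ℕ, σ (n + j) ^ 2) * ‖c‖ := by
  refine lp.norm_le_of_forall_sum_le (by simp) (by positivity) fun s => ?_
  simpa [ha] using sum_norm_div_le hw hsum hσe c hc s

lemma exists_embedding_ellOne (hw : ∀ k, 0 < w k)
    (hsum : Summable fun k : ZLat d => (w k)⁻¹ ^ 2) (hσe : ∀ j, σ j = (w (e j))⁻¹) :
    ∃ TA : ellTwo d →L[ℂ] ellOne d, ∀ (c : ellTwo d) (k : ZLat d), TA c k = c k / (w k : ℂ) := by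
  have hmem : ∀ c : ellTwo d, Memℓp (fun k => c k / (w k : ℂ)) 1 := fun c =>
    memℓp_gen' (C := Real.sqrt (∑' j : ℕ, σ (0 + j) ^ 2) * ‖c‖) fun s => by
      simpa using sum_norm_div_le hw hsum hσe (n := 0) c (by simp) s
  let L : ellTwo d →ₗ[ℂ] ellOne d :=
    { toFun := fun c => ⟨fun k => c k / (w k : ℂ), hmem c⟩
      map_add' := fun a b => by
        ext k
        exact add_div _ _ _
      map_smul' := fun z a => by
        ext k
        exact mul_div_assoc _ _ _ }
  exact ⟨L.mkContinuous (Real.sqrt (∑' j : ℕ, σ (0 + j) ^ 2)) fun c =>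
    norm_le_of_eq_div hw hsum hσe (n := 0) (by simp) fun k => rfl, fun c k => rfl⟩

lemma linftyToL2_eq_smul (hσe : ∀ j, σ j = (w (e j))⁻¹) {j : ℕ}
    {f : Lp ℂ ⊤ (torusMeasure d)}
    (hf : ∀ k, fourierCoef f k = (lp.single 2 (e j) 1 : ellTwo d) k / (w k : ℂ)) :
    linftyToL2 _ f = (σ j : ℂ) • torusMonomialL2 (e j) := by
  apply (torusBasis d).repr.injective
  ext k
  rw [torusBasis_repr, fourierCoef_congr (coeFn_linftyToL2 f), hf, map_smul, ← coe_torusBasis,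
    HilbertBasis.repr_self, lp.coeFn_smul, Pi.smul_apply, lp.single_apply, Pi.single_apply]
  split_ifs with h
  · simp [h, hσe]
  · simp

lemma sqrt_tail_le_approxNum {Y : Type*} [NormedAddCommGroup Y] [NormedSpace ℂ Y]
    (hw : ∀ k, 0 < w k) (hσ : Antitone σ)
    (hσe : ∀ j, σ j = (w (e j))⁻¹) (T : ellTwo d →L[ℂ] Y) (J : Y →L[ℂ] Lp ℂ ⊤ (torusMeasure d))
    (hJ : ‖J‖ ≤ 1) (hT : ∀ (c : ellTwo d) (k : ZLat d), fourierCoef (J (T c)) k = c k / (w k : ℂ))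
    (n : ℕ) : Real.sqrt (∑' j : ℕ, σ (n + j) ^ 2) ≤ approxNum T (n + 1) := by
  refine le_approxNum_succ T fun A hfin hA => ?_
  have hσ0 : ∀ j, 0 ≤ σ j := fun j => by rw [hσe]; exact (inv_pos.2 (hw _)).le
  have hJTA : ‖J ∘L (T - A)‖ ≤ ‖T - A‖ :=
    (J.opNorm_comp_le _).trans (mul_le_of_le_one_left (norm_nonneg _) hJ)
  refine Real.sqrt_le_iff.2 ⟨norm_nonneg _, ?_⟩
  refine Real.tsum_le_of_sum_range_le (fun _ => sq_nonneg _) fun m => ?_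
  let ι : Y →ₗ[ℂ] Lp ℂ 2 (torusMeasure d) := linftyToL2 (torusMeasure d) ∘ₗ (J : Y →ₗ[ℂ] _)
  let u : ℕ → ellTwo d := fun j => lp.single 2 (e j) 1
  have hu : Orthonormal ℂ u := orthonormal_lp_single.comp e e.injective
  let F := (LinearMap.range (A : ellTwo d →ₗ[ℂ] Y)).map ι
  have hF : Module.finrank ℂ F ≤ n := (Submodule.finrank_map_le _ _).trans hA
  have h1 := sum_tail_sq_le_sum_norm_sq
    ((orthonormal_torusMonomialL2 d).comp e e.injective) hσ hσ0 F hF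
    (y := fun j => ι (A (u j))) (fun j => Submodule.mem_map_of_mem ⟨u j, rfl⟩) m
  refine h1.trans (le_trans ?_ (pow_le_pow_left₀ (norm_nonneg _) hJTA 2))
  rw [Finset.sum_range]
  refine le_trans (le_of_eq (Finset.sum_congr rfl fun j _ => ?_))
    (sum_norm_sq_linftyToL2_apply_le (J ∘L (T - A))
      (hu.comp (fun i : Fin (n + m) => (i : ℕ)) Fin.val_injective))
  rw [Function.comp_apply, ← linftyToL2_eq_smul hσe (hT (u j)), Function.comp_apply,
    ContinuousLinearMap.comp_apply, sub_apply, map_sub, map_sub]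
  rfl

lemma approxNum_eq_sqrt_tail {Y : Type*} [NormedAddCommGroup Y] [NormedSpace ℂ Y]
    (hw : ∀ k, 0 < w k) (hsum : Summable fun k : ZLat d => (w k)⁻¹ ^ 2) (hσ : Antitone σ)
    (hσe : ∀ j, σ j = (w (e j))⁻¹) (T : ellTwo d →L[ℂ] Y) (J : Y →L[ℂ] Lp ℂ ⊤ (torusMeasure d))
    (hJ : ‖J‖ ≤ 1) (hT : ∀ (c : ellTwo d) (k : ZLat d), fourierCoef (J (T c)) k = c k / (w k : ℂ))
    (hle : ∀ (c : ellTwo d) (a : ellOne d), (∀ k, a k = c k / (w k : ℂ)) → ‖T c‖ ≤ ‖a‖)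
    (n : ℕ) : approxNum T (n + 1) = Real.sqrt (∑' j : ℕ, σ (n + j) ^ 2) := by
  refine le_antisymm ?_ (sqrt_tail_le_approxNum hw hσ hσe T J hJ hT n)
  obtain ⟨TA, hTA⟩ := exists_embedding_ellOne hw hsum hσe
  exact approxNum_succ_le_of_forall T e (Real.sqrt_nonneg _) fun c hc =>
    (hle c (TA c) (hTA c)).trans (norm_le_of_eq_div hw hsum hσe hc (hTA c))

lemma approxNum_L2_eq (hw : ∀ k, 0 < w k) (hσ : Antitone σ) (hσe : ∀ j, σ j = (w (e j))⁻¹)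
    (T : ellTwo d →L[ℂ] Lp ℂ 2 (torusMeasure d))
    (hT : ∀ (c : ellTwo d) (k : ZLat d), fourierCoef (T c) k = c k / (w k : ℂ)) (n : ℕ) :
    approxNum T (n + 1) = σ n := by
  have hσpos : ∀ j, 0 < σ j := fun j => by rw [hσe]; exact inv_pos.2 (hw _)
  have hrepr : ∀ (c : ellTwo d) (j : ℕ),
      ‖(torusBasis d).repr (T c) (e j)‖ = σ j * ‖c (e j)‖ := fun c j => by
    rw [torusBasis_repr, hT, norm_div, Complex.norm_real, Real.norm_of_nonneg (hw _).le, hσe,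
      div_eq_inv_mul]
  apply le_antisymm
  · refine approxNum_succ_le_of_forall T e (hσpos n).le fun c hc => ?_
    rw [← (torusBasis d).repr.norm_map]
    refine lp_two_norm_le_of_forall (hσpos n).le (e.forall_congr_right.1 fun j => ?_)
    rw [hrepr]
    rcases lt_or_ge j n with h | h
    · simp [hc j h]
    · exact mul_le_mul_of_nonneg_right (hσ h) (norm_nonneg _)
  · refine le_approxNum_succ T fun A hfin hA => ?_
    let u : Fin (n + 1) → ellTwo d := fun j => lp.single 2 (e j) 1
    have hu : Orthonormal ℂ u :=
      orthonormal_lp_single.comp (fun j : Fin (n + 1) => e j) (e.injective.comp Fin.val_injective)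
    let L : (Fin (n + 1) → ℂ) →ₗ[ℂ] ellTwo d := Fintype.linearCombination ℂ u
    obtain ⟨a, ha, ha0⟩ := Submodule.exists_mem_ne_zero_of_ne_bot
      (LinearMap.ker_ne_bot_of_finrank_lt
        (f := (A : ellTwo d →ₗ[ℂ] Lp ℂ 2 (torusMeasure d)).rangeRestrict ∘ₗ L)
        (by simpa using Nat.lt_succ_of_le hA))
    have hAL : A (L a) = 0 := congrArg Subtype.val (LinearMap.mem_ker.1 ha)
    have hL0 : L a ≠ 0 := fun h => ha0 <| by
      have := hu.linearIndependent.fintypeLinearCombination_injective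
      exact this (h.trans (map_zero L).symm)
    have hLj : ∀ j, n < j → L a (e j) = 0 := by
      intro j hj
      rw [Fintype.linearCombination_apply, lp.coeFn_sum, Finset.sum_apply]
      refine Finset.sum_eq_zero fun i _ => ?_
      have hne : e j ≠ e i := fun h => by
        have := e.injective h
        omega
      rw [lp.coeFn_smul, Pi.smul_apply, lp.single_apply_ne _ _ _ hne, smul_zero]
    have h1 : ‖L a‖ ≤ (σ n)⁻¹ * ‖(torusBasis d).repr (T (L a))‖ := by
      refine lp_two_norm_le_of_forall (inv_pos.2 (hσpos n)).le
        (e.forall_congr_right.1 fun j => ?_)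
      rw [hrepr, ← div_eq_inv_mul, le_div_iff₀ (hσpos n), mul_comm]
      rcases lt_or_ge n j with h | h
      · simp [hLj j h]
      · exact mul_le_mul_of_nonneg_right (hσ h) (norm_nonneg _)
    have h2 := (T - A).le_opNorm (L a)
    rw [sub_apply, hAL, sub_zero] at h2
    rw [(torusBasis d).repr.norm_map, ← div_eq_inv_mul, le_div_iff₀ (hσpos n), mul_comm] at h1
    exact le_of_mul_le_mul_right (h1.trans h2) (norm_pos_iff.2 hL0)

end Embeddings

/-- The inclusion of `C(𝕋^d)` into `L_∞(𝕋^d)`. -/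
def continuousToLinfty (d : ℕ) : C(Torus d, ℂ) →L[ℂ] Lp ℂ ⊤ (torusMeasure d) :=
  ContinuousMap.toLp ⊤ (torusMeasure d) ℂ

lemma norm_continuousToLinfty_le (d : ℕ) : ‖continuousToLinfty d‖ ≤ 1 := by
  unfold continuousToLinfty
  simpa using ContinuousMap.toLp_norm_le (p := ⊤) (μ := torusMeasure d) (E := ℂ) (𝕜 := ℂ)

lemma fourierCoef_continuousToLinfty {d : ℕ} (f : C(Torus d, ℂ)) (k : ZLat d) :
    fourierCoef (continuousToLinfty d f) k = fourierCoef f k :=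
  fourierCoef_congr (ContinuousMap.coeFn_toLp _ f) k

/-- Theorem 2 of Cobos–Kühn–Sickel. If `∑_k w(k)^{-2} < ∞`, the
embeddings of `F_d(w)` into `A(𝕋^d)`, `C(𝕋^d)` and `L_∞(𝕋^d)` exist, and their
approximation numbers all equal `(∑_{j=n}^∞ σ_j²)^{1/2}`, where `σ` (indexed from `0`)
is the non-increasing rearrangement of `(1/w(k))_k`.  In particular, since
`σ_j = a_j(I_d : F_d(w) → L₂(𝕋^d))`, one has
`a_n(I_d : F_d(w) → L_∞) = (∑_{j=n}^∞ a_j(I_d : F_d(w) → L₂)²)^{1/2}`. -/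
theorem statement3 (d : ℕ) (hd : 0 < d) (w : ZLat d → ℝ) (hw : ∀ k, 0 < w k)
    (hsum : Summable fun k : ZLat d => (w k)⁻¹ ^ 2)
    (σ : ℕ → ℝ) (hσ : Antitone σ) (e : ℕ ≃ ZLat d) (hσe : ∀ j, σ j = (w (e j))⁻¹) :
    ((∃ TA : ellTwo d →L[ℂ] ellOne d,
        ∀ (c : ellTwo d) (k : ZLat d), TA c k = c k / (w k : ℂ)) ∧
     (∃ TC : ellTwo d →L[ℂ] C(Torus d, ℂ),
        ∀ (c : ellTwo d) (k : ZLat d), fourierCoef (⇑(TC c)) k = c k / (w k : ℂ)) ∧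
     (∃ Ti : ellTwo d →L[ℂ] Lp ℂ ⊤ (torusMeasure d),
        ∀ (c : ellTwo d) (k : ZLat d), fourierCoef (⇑(Ti c)) k = c k / (w k : ℂ)) ∧
     (∃ T2 : ellTwo d →L[ℂ] Lp ℂ 2 (torusMeasure d),
        ∀ (c : ellTwo d) (k : ZLat d), fourierCoef (⇑(T2 c)) k = c k / (w k : ℂ))) ∧
    (∀ TA : ellTwo d →L[ℂ] ellOne d,
       (∀ (c : ellTwo d) (k : ZLat d), TA c k = c k / (w k : ℂ)) →
       ∀ n : ℕ, approxNum TA (n + 1) = Real.sqrt (∑' j : ℕ, σ (n + j) ^ 2)) ∧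
    (∀ TC : ellTwo d →L[ℂ] C(Torus d, ℂ),
       (∀ (c : ellTwo d) (k : ZLat d), fourierCoef (⇑(TC c)) k = c k / (w k : ℂ)) →
       ∀ n : ℕ, approxNum TC (n + 1) = Real.sqrt (∑' j : ℕ, σ (n + j) ^ 2)) ∧
    (∀ Ti : ellTwo d →L[ℂ] Lp ℂ ⊤ (torusMeasure d),
       (∀ (c : ellTwo d) (k : ZLat d), fourierCoef (⇑(Ti c)) k = c k / (w k : ℂ)) →
       ∀ n : ℕ, approxNum Ti (n + 1) = Real.sqrt (∑' j : ℕ, σ (n + j) ^ 2)) ∧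
    (∀ Ti : ellTwo d →L[ℂ] Lp ℂ ⊤ (torusMeasure d),
       (∀ (c : ellTwo d) (k : ZLat d), fourierCoef (⇑(Ti c)) k = c k / (w k : ℂ)) →
       ∀ T2 : ellTwo d →L[ℂ] Lp ℂ 2 (torusMeasure d),
       (∀ (c : ellTwo d) (k : ZLat d), fourierCoef (⇑(T2 c)) k = c k / (w k : ℂ)) →
       (∀ j : ℕ, σ j = approxNum T2 (j + 1)) ∧
       ∀ n : ℕ, approxNum Ti (n + 1) =
         Real.sqrt (∑' j : ℕ, approxNum T2 (n + 1 + j) ^ 2)) := by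
  obtain ⟨TA₀, hTA₀⟩ := exists_embedding_ellOne hw hsum hσe
  have hinf : ∀ Ti : ellTwo d →L[ℂ] Lp ℂ ⊤ (torusMeasure d),
      (∀ (c : ellTwo d) (k : ZLat d), fourierCoef (⇑(Ti c)) k = c k / (w k : ℂ)) →
      ∀ n : ℕ, approxNum Ti (n + 1) = Real.sqrt (∑' j : ℕ, σ (n + j) ^ 2) := by
    intro Ti hTi
    refine approxNum_eq_sqrt_tail hw hsum hσ hσe Ti (ContinuousLinearMap.id ℂ _)
      ContinuousLinearMap.norm_id_le hTi fun c a ha => ?_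
    have h1 : Ti c = continuousToLinfty d (wienerEmbedding d a) := by
      refine Lp.ext (ae_eq_of_fourierCoef_eq ((Lp.memLp _).mono_exponent le_top)
        ((Lp.memLp _).mono_exponent le_top) fun k => ?_)
      rw [hTi, fourierCoef_continuousToLinfty, fourierCoef_wienerEmbedding, ha]
    rw [h1]
    exact ((continuousToLinfty d).le_of_opNorm_le (norm_continuousToLinfty_le d) _).trans <| by
      simpa using (wienerEmbedding d).le_of_opNorm_le (norm_wienerEmbedding_le d) a
  refine ⟨⟨⟨TA₀, hTA₀⟩, ⟨wienerEmbedding d ∘L TA₀, fun c k => ?_⟩,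
    ⟨continuousToLinfty d ∘L wienerEmbedding d ∘L TA₀, fun c k => ?_⟩,
    ⟨ContinuousMap.toLp 2 (torusMeasure d) ℂ ∘L wienerEmbedding d ∘L TA₀, fun c k => ?_⟩⟩,
    fun TA hTA => ?_, fun TC hTC => ?_, hinf, fun Ti hTi T2 hT2 => ?_⟩
  · exact (fourierCoef_wienerEmbedding _ _).trans (hTA₀ c k)
  · exact (fourierCoef_continuousToLinfty _ _).trans
      ((fourierCoef_wienerEmbedding _ _).trans (hTA₀ c k))
  · exact (fourierCoef_congr (ContinuousMap.coeFn_toLp _ _) k).trans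
      ((fourierCoef_wienerEmbedding _ _).trans (hTA₀ c k))
  · refine approxNum_eq_sqrt_tail hw hsum hσ hσe TA (continuousToLinfty d ∘L wienerEmbedding d)
      ?_ (fun c k => ?_) fun c a ha => ?_
    · exact (ContinuousLinearMap.opNorm_comp_le _ _).trans
        (mul_le_one₀ (norm_continuousToLinfty_le d) (norm_nonneg _) (norm_wienerEmbedding_le d))
    · exact (fourierCoef_continuousToLinfty _ _).trans
        ((fourierCoef_wienerEmbedding _ _).trans (hTA c k))
    · have : TA c = a := lp.ext (funext fun k => (hTA c k).trans (ha k).symm)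
      rw [this]
  · refine approxNum_eq_sqrt_tail hw hsum hσ hσe TC (continuousToLinfty d)
      (norm_continuousToLinfty_le d)
      (fun c k => (fourierCoef_continuousToLinfty _ _).trans (hTC c k)) fun c a ha => ?_
    have h1 : TC c = wienerEmbedding d a := eq_of_fourierCoef_eq fun k => by
      rw [hTC, fourierCoef_wienerEmbedding, ha]
    rw [h1]
    simpa using (wienerEmbedding d).le_of_opNorm_le (norm_wienerEmbedding_le d) a
  · have h2 := approxNum_L2_eq hw hσ hσe T2 hT2
    refine ⟨fun j => (h2 j).symm, fun n => ?_⟩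
    rw [hinf Ti hTi n]
    simp only [Nat.add_right_comm n 1, h2]
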